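/- Let x^{rand,m} ∈ [0,1]^m have i.i.d. entries uniformly distributed on [0,1], and let C_0(x^{rand,m}) = max_{s ∈ [0,1]} min_{1 ≤ j ≤ m} |s − x^{rand,m}_j| (equal to 1 when m = 0). Then for all m ≥ 0, E[C_0(x^{rand,m})] ≥ H_{m+1}/(2(m+1)), and for all m ≥ 2, E[C_0(x^{rand,m})] ≤ (H_{m−1} + 4)/(2(m+1)). -/

import Mathlib

open Finset MeasureTheory

/-- Coverage cost on the line `[0,1]` for placement `x` and active set `A`:
the largest distance from a point of `[0,1]` to the closest active sensor
(`1` by convention if `A = ∅`). -/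
noncomputable def cost0 {n : ℕ} (x : Fin n → ℝ) (A : Finset (Fin n)) : ℝ :=
  if A.Nonempty then ⨆ s : Set.Icc (0:ℝ) 1, ⨅ j : A, |s.1 - x j.1| else 1

/-- Probability that `A` is the active set, under independent failures with
probability `p`. -/
noncomputable def prob {n : ℕ} (p : ℝ) (A : Finset (Fin n)) : ℝ :=
  p ^ (n - A.card) * (1 - p) ^ A.card

/-- Expected coverage cost `C(x)` under independent failures with probability `p`. -/
noncomputable def expCost {n : ℕ} (p : ℝ) (x : Fin n → ℝ) : ℝ :=
  ∑ A : Finset (Fin n), prob p A * cost0 x A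

/-- The equispaced placement `x^eq`, whose `i`-th entry (`i = 0, …, n-1`) is
`(2i+1)/(2n)`. -/
noncomputable def xeq (n : ℕ) : Fin n → ℝ := fun i => (2 * (i : ℝ) + 1) / (2 * n)

/-- The `k`-th smallest element of the finite set `A` (0-based). -/
noncomputable def nth {n : ℕ} (A : Finset (Fin n)) (k : Fin A.card) : Fin n :=
  (A.orderIsoOfFin rfl k).1

/-- Coverage cost on the circle of circumference 1 for the active set `A`. -/
noncomputable def ccost0 {n : ℕ} (x : Fin n → ℝ) (A : Finset (Fin n)) : ℝ :=
  if A.Nonempty then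
    ⨆ s : Set.Icc (0:ℝ) 1, ⨅ j : A, min |s.1 - x j.1| (1 - |s.1 - x j.1|)
  else 1

/-- Expected circle coverage cost `C̃(x)`. -/
noncomputable def cExpCost {n : ℕ} (p : ℝ) (x : Fin n → ℝ) : ℝ :=
  ∑ A : Finset (Fin n), prob p A * ccost0 x A

/-- Harmonic number `H_m = ∑_{h=1}^m 1/h`. -/
noncomputable def H (m : ℕ) : ℝ := ∑ i ∈ Finset.range m, 1 / ((i : ℝ) + 1)

/-- Length of the longest run of consecutive indices of `{0, …, n-1}` not
belonging to `A`. -/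
noncomputable def longestRun {n : ℕ} (A : Finset (Fin n)) : ℕ :=
  sSup {r : ℕ | ∃ a : ℕ, a + r ≤ n ∧ ∀ i : Fin n, a ≤ i.1 → i.1 < a + r → i ∉ A}

/-- Expected cost in the Cortés (constant-number-of-failures) model where
exactly `k` sensors fail, uniformly at random. -/
noncomputable def cortesCost {n : ℕ} (k : ℕ) (x : Fin n → ℝ) : ℝ :=
  (n.choose k : ℝ)⁻¹ *
    ∑ A ∈ Finset.univ.filter (fun A : Finset (Fin n) => A.card = n - k), cost0 x A

/-- Expectation over the random uniform i.i.d. placement `x^rand ∈ [0,1]^n`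
of the expected cost `C(x^rand)`. -/
noncomputable def randExp (n : ℕ) (p : ℝ) : ℝ :=
  ∫ x in Set.univ.pi (fun _ : Fin n => Set.Icc (0:ℝ) 1), expCost p x

/-- `E[C_0(x^{rand,m})]`: expected coverage cost of `m` i.i.d. uniform sensors,
all active. -/
noncomputable def randCost0 (m : ℕ) : ℝ :=
  ∫ x in Set.univ.pi (fun _ : Fin m => Set.Icc (0:ℝ) 1), cost0 x Finset.univ

/-- `E[C^{k,n}(x^rand)]`: expectation over the random placement of the Cortés
model cost. -/
noncomputable def randCortes (n k : ℕ) : ℝ :=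
  ∫ x in Set.univ.pi (fun _ : Fin n => Set.Icc (0:ℝ) 1), cortesCost k x

/-- The truncated power `u ↦ u₊ ^ n`, equal to the indicator of `[0, ∞)` for `n = 0`. -/
noncomputable def truncPow (n : ℕ) (u : ℝ) : ℝ := if 0 ≤ u then u ^ n else 0

theorem truncPow_of_nonneg {n : ℕ} {u : ℝ} (hu : 0 ≤ u) : truncPow n u = u ^ n := if_pos hu

theorem truncPow_of_neg {n : ℕ} {u : ℝ} (hu : u < 0) : truncPow n u = 0 := if_neg hu.not_ge

theorem truncPow_succ_of_nonpos {n : ℕ} {u : ℝ} (hu : u ≤ 0) : truncPow (n + 1) u = 0 := by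
  rcases hu.lt_or_eq with h | rfl
  · exact truncPow_of_neg h
  · simp [truncPow]

theorem truncPow_succ_eq_max (n : ℕ) : truncPow (n + 1) = fun u => max u 0 ^ (n + 1) := by
  ext u
  rcases le_total 0 u with h | h
  · rw [truncPow_of_nonneg h, max_eq_left h]
  · rw [truncPow_succ_of_nonpos h, max_eq_right h]; simp

theorem continuous_truncPow_succ (n : ℕ) : Continuous (truncPow (n + 1)) := by
  rw [truncPow_succ_eq_max]
  fun_prop

theorem monotone_truncPow (n : ℕ) : Monotone (truncPow n) := by
  intro u v h
  rcases lt_or_ge u 0 with hu | hu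
  · rw [truncPow_of_neg hu, truncPow]
    split_ifs with hv
    · positivity
    · exact le_rfl
  · rw [truncPow_of_nonneg hu, truncPow_of_nonneg (hu.trans h)]
    gcongr

theorem truncPow_nonneg (n : ℕ) (u : ℝ) : 0 ≤ truncPow n u := by
  rw [truncPow]
  split_ifs with hu
  · positivity
  · exact le_rfl

theorem hasDerivWithinAt_truncPow_succ (n : ℕ) (u : ℝ) :
    HasDerivWithinAt (truncPow (n + 1)) ((n + 1) * truncPow n u) (Set.Ioi u) u := by
  rcases lt_or_ge u 0 with hu | hu
  · rw [truncPow_of_neg hu, mul_zero]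
    have h : truncPow (n + 1) =ᶠ[nhds u] fun _ => (0 : ℝ) := by
      filter_upwards [Iio_mem_nhds hu] with v hv using truncPow_of_neg hv
    exact ((hasDerivAt_const u (0 : ℝ)).congr_of_eventuallyEq h).hasDerivWithinAt
  · rw [truncPow_of_nonneg hu]
    have h := (hasDerivAt_pow (n + 1) u).hasDerivWithinAt (s := Set.Ioi u)
    simp only [Nat.add_sub_cancel, Nat.cast_add, Nat.cast_one] at h
    refine h.congr (fun v hv => truncPow_of_nonneg (hu.trans (le_of_lt hv)))
      (truncPow_of_nonneg hu)

theorem intervalIntegrable_truncPow (n : ℕ) (u v : ℝ) :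
    IntervalIntegrable (truncPow n) volume u v :=
  (monotone_truncPow n).intervalIntegrable

theorem mul_integral_truncPow (n : ℕ) {u v : ℝ} (h : u ≤ v) :
    (n + 1) * ∫ w in u..v, truncPow n w = truncPow (n + 1) v - truncPow (n + 1) u := by
  rw [← intervalIntegral.integral_const_mul]
  exact intervalIntegral.integral_eq_sub_of_hasDeriv_right_of_le h
    (continuous_truncPow_succ n).continuousOn
    (fun w _ => hasDerivWithinAt_truncPow_succ n w)
    ((intervalIntegrable_truncPow n u v).const_mul _)

/-- Integrability and integral over `(0, ∞)` of `r ↦ (1 - c r)₊ ^ n`. -/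
theorem integral_truncPow_one_sub_mul (n : ℕ) {c : ℝ} (hc : 0 < c) :
    IntegrableOn (fun r => truncPow n (1 - c * r)) (Set.Ioi 0) ∧
      ∫ r in Set.Ioi (0 : ℝ), truncPow n (1 - c * r) = 1 / (c * (n + 1)) := by
  have hzero : ∀ r ∈ Set.Ioi (0 : ℝ) \ Set.Ioc 0 (1 / c), truncPow n (1 - c * r) = 0 := by
    rintro r ⟨hr, hr'⟩
    have : 1 / c < r := by
      by_contra! h
      exact hr' ⟨hr, h⟩
    rw [div_lt_iff₀ hc] at this
    exact truncPow_of_neg (by linarith)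
  have hanti : Antitone fun r => truncPow n (1 - c * r) := fun r s h =>
    monotone_truncPow n (by nlinarith)
  have hint : IntervalIntegrable (fun r => truncPow n (1 - c * r)) volume 0 (1 / c) :=
    hanti.intervalIntegrable
  have hc' : (0 : ℝ) ≤ 1 / c := by positivity
  constructor
  · exact (((intervalIntegrable_iff_integrableOn_Ioc_of_le hc').1 hint)).of_forall_sdiff_eq_zero
      measurableSet_Ioi hzero
  · rw [setIntegral_eq_of_subset_of_forall_sdiff_eq_zero measurableSet_Ioi
      Set.Ioc_subset_Ioi_self hzero, ← intervalIntegral.integral_of_le hc',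
      intervalIntegral.integral_comp_sub_mul (truncPow n) hc.ne']
    have h := mul_integral_truncPow n (zero_le_one (α := ℝ))
    rw [truncPow_succ_of_nonpos le_rfl, truncPow_of_nonneg zero_le_one, one_pow,
      sub_zero] at h
    have h1 : 1 - c * (1 / c) = 0 := by field_simp; ring
    have hn : (n + 1 : ℝ) ≠ 0 := by positivity
    rw [h1, mul_zero, sub_zero, smul_eq_mul]
    field_simp
    linarith

/-- The harmonic numbers as an alternating binomial sum. -/
theorem sum_alternating_choose_div_eq_H (n : ℕ) :
    ∑ k ∈ Finset.range n, (-1 : ℝ) ^ k * (n.choose (k + 1)) / ((k : ℝ) + 1) = H n := by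
  induction n with
  | zero => simp [H]
  | succ n ih =>
    have halt : ∑ k ∈ Finset.range (n + 1), (-1 : ℝ) ^ k * ((n + 1).choose (k + 1)) = 1 := by
      have h := congrArg (Int.cast : ℤ → ℝ)
        (Int.alternating_sum_range_choose_of_ne (n := n + 1) (by omega))
      push_cast at h
      rw [Finset.sum_range_succ'] at h
      simp only [pow_succ, mul_neg, mul_one, neg_mul, Finset.sum_neg_distrib] at h
      simp at h
      linarith
    have hterm : ∀ k ∈ Finset.range (n + 1),
        (-1 : ℝ) ^ k * ((n + 1).choose (k + 1)) / ((k : ℝ) + 1) =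
          (-1 : ℝ) ^ k * ((n + 1).choose (k + 1)) * (1 / ((n : ℝ) + 1)) +
            (-1 : ℝ) ^ k * (n.choose (k + 1)) / ((k : ℝ) + 1) := by
      intro k _
      have h1 : ((n : ℝ) + 1) * n.choose k = (n + 1).choose (k + 1) * ((k : ℝ) + 1) := by
        exact_mod_cast Nat.add_one_mul_choose_eq n k
      have h2 : ((n + 1).choose (k + 1) : ℝ) = n.choose k + n.choose (k + 1) := by
        exact_mod_cast Nat.choose_succ_succ n k
      have hk : (k : ℝ) + 1 ≠ 0 := by positivity
      have hn : (n : ℝ) + 1 ≠ 0 := by positivity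
      field_simp
      rw [h2] at h1 ⊢
      linear_combination h1
    rw [Finset.sum_congr rfl hterm, Finset.sum_add_distrib, ← Finset.sum_mul, halt,
      Finset.sum_range_succ (fun k : ℕ => (-1 : ℝ) ^ k * (n.choose (k + 1)) / ((k : ℝ) + 1)), ih,
      H, H, Finset.sum_range_succ]
    simp
    ring

/-- Configurations of distinct points of `(a, 1]` cutting `[a, 1]` into pieces shorter than `t`. -/
def noGap (m : ℕ) (a t : ℝ) : Set (Fin m → ℝ) :=
  {x | Function.Injective x ∧ (∀ i, a < x i ∧ x i ≤ 1) ∧ (1 < a + t ∨ ∃ j, x j < a + t) ∧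
    ∀ i, 1 < x i + t ∨ ∃ j, x i < x j ∧ x j < x i + t}

theorem measurableSet_noGap_prod (m : ℕ) (t : ℝ) :
    MeasurableSet {p : ℝ × (Fin m → ℝ) | p.2 ∈ noGap m p.1 t} := by
  have hx : ∀ i : Fin m, Measurable fun p : ℝ × (Fin m → ℝ) => p.2 i := fun i =>
    (measurable_pi_apply i).comp measurable_snd
  refine Measurable.setOf ?_
  simp only [noGap, Function.Injective, Set.mem_ofPred_eq]
  refine .and (.forall fun i => .forall fun j => .imp ?_ measurable_const) <|
    .and (.forall fun i => .and ?_ ?_) <| .and (.or ?_ (.exists fun j => ?_)) <|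
    .forall fun i => .or ?_ (.exists fun j => .and ?_ ?_)
  · exact measurableSet_setOfPred.1 (measurableSet_eq_fun (hx i) (hx j))
  · exact measurableSet_setOfPred.1 (measurableSet_lt measurable_fst (hx i))
  · exact measurableSet_setOfPred.1 (measurableSet_le (hx i) measurable_const)
  · exact measurableSet_setOfPred.1 (measurableSet_lt measurable_const (measurable_fst.add_const t))
  · exact measurableSet_setOfPred.1 (measurableSet_lt (hx j) (measurable_fst.add_const t))
  · exact measurableSet_setOfPred.1 (measurableSet_lt measurable_const ((hx i).add_const t))
  · exact measurableSet_setOfPred.1 (measurableSet_lt (hx i) (hx j))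
  · exact measurableSet_setOfPred.1 (measurableSet_lt (hx j) ((hx i).add_const t))

theorem measurableSet_noGap (m : ℕ) (a t : ℝ) : MeasurableSet (noGap m a t) :=
  (measurable_prodMk_left (x := a)) (measurableSet_noGap_prod m t)

/-- The part of `noGap (m + 1) a t` where `x i` is the smallest point, in the coordinates
`(x i, x ∘ i.succAbove)`. -/
def noGapMin (m : ℕ) (a t : ℝ) : Set (ℝ × (Fin m → ℝ)) :=
  {p | p.1 ∈ Set.Ioc a 1 ∩ Set.Iio (a + t) ∧ p.2 ∈ noGap m p.1 t}

theorem measurableSet_noGapMin (m : ℕ) (a t : ℝ) : MeasurableSet (noGapMin m a t) :=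
  (measurable_fst (measurableSet_Ioc.inter measurableSet_Iio)).inter
    (measurableSet_noGap_prod m t)

theorem insertNth_mem_noGap_iff {m : ℕ} {a t y : ℝ} (i : Fin (m + 1)) {x : Fin m → ℝ}
    (hy : ∀ j, y < x j) :
    (i.insertNth y x : Fin (m + 1) → ℝ) ∈ noGap (m + 1) a t ↔ (y, x) ∈ noGapMin m a t := by
  simp only [noGap, noGapMin, Set.mem_ofPred_eq, Fin.forall_iff_succAbove i,
    Fin.exists_iff_succAbove i, Fin.insertNth_apply_same, Fin.insertNth_apply_succAbove,
    Set.mem_inter_iff, Set.mem_Ioc, Set.mem_Iio, Function.Injective]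
  constructor
  · rintro ⟨hinj, ⟨⟨h1, h2⟩, h3⟩, h4, h5, h6⟩
    refine ⟨⟨⟨h1, h2⟩, ?_⟩, ?_, fun j => ⟨hy j, (h3 j).2⟩, ?_, ?_⟩
    · rcases h4 with h | h | ⟨j, h⟩
      · linarith
      · exact h
      · exact (hy j).trans h
    · intro j k hjk
      exact Fin.succAbove_right_injective ((hinj.2 j).2 k hjk)
    · rcases h5 with h | h | ⟨j, h⟩
      · exact .inl h
      · exact absurd h.1 (lt_irrefl _)
      · exact .inr ⟨j, h.2⟩
    · intro j
      rcases h6 j with h | h | h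
      · exact .inl h
      · exact absurd h.1 (hy j).not_gt
      · exact .inr h
  · rintro ⟨⟨⟨h1, h2⟩, h3⟩, hinj, h4, h5, h6⟩
    refine ⟨⟨⟨fun _ => trivial, fun j h => absurd h (hy j).ne⟩, fun j => ⟨fun h => absurd h (hy j).ne',
      fun k h => by rw [hinj h]⟩⟩, ⟨⟨h1, h2⟩, fun j => ⟨h1.trans (hy j), (h4 j).2⟩⟩,
      .inr (.inl h3), ?_, fun j => ?_⟩
    · rcases h5 with h | ⟨j, h⟩
      · exact .inl h
      · exact .inr (.inr ⟨j, hy j, h⟩)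
    · rcases h6 j with h | h
      · exact .inl h
      · exact .inr (.inr h)

theorem noGap_succ_eq_iUnion (m : ℕ) (a t : ℝ) :
    noGap (m + 1) a t =
      ⋃ i, MeasurableEquiv.piFinSuccAbove (fun _ => ℝ) i ⁻¹' noGapMin m a t := by
  ext x
  simp only [Set.mem_iUnion, Set.mem_preimage]
  have hins : ∀ i, MeasurableEquiv.piFinSuccAbove (fun _ => ℝ) i x = (x i, i.removeNth x) :=
    fun i => rfl
  constructor
  · intro hx
    obtain ⟨i, hi⟩ := Finite.exists_min x
    refine ⟨i, ?_⟩
    rw [hins, ← insertNth_mem_noGap_iff i, Fin.insertNth_self_removeNth]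
    · exact hx
    · intro j
      exact (hi _).lt_of_ne fun h => Fin.succAbove_ne i j (hx.1 h).symm
  · rintro ⟨i, hi⟩
    rw [hins] at hi
    rw [← insertNth_mem_noGap_iff i (fun j => (hi.2.2.1 j).1),
      Fin.insertNth_self_removeNth] at hi
    exact hi

theorem pairwise_disjoint_noGapMin (m : ℕ) (a t : ℝ) :
    Pairwise (Function.onFun Disjoint fun i =>
      MeasurableEquiv.piFinSuccAbove (fun _ : Fin (m + 1) => ℝ) i ⁻¹' noGapMin m a t) := by
  have hlt : ∀ {i j : Fin (m + 1)} {x : Fin (m + 1) → ℝ}, i ≠ j →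
      MeasurableEquiv.piFinSuccAbove (fun _ => ℝ) i x ∈ noGapMin m a t → x i < x j := by
    intro i j x hij hx
    obtain ⟨k, rfl⟩ := Fin.exists_succAbove_eq hij.symm
    exact (hx.2.2.1 k).1
  intro i j hij
  exact Set.disjoint_left.2 fun x hi hj => lt_asymm (hlt hij hi) (hlt hij.symm hj)

theorem volume_noGap_succ (m : ℕ) (a t : ℝ) :
    volume (noGap (m + 1) a t) =
      (m + 1 : ℕ) * ∫⁻ y in Set.Ioc a 1 ∩ Set.Iio (a + t), volume (noGap m y t) := by
  have hpiece : ∀ i : Fin (m + 1),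
      volume (MeasurableEquiv.piFinSuccAbove (fun _ => ℝ) i ⁻¹' noGapMin m a t) =
        ∫⁻ y in Set.Ioc a 1 ∩ Set.Iio (a + t), volume (noGap m y t) := by
    intro i
    rw [(volume_preserving_piFinSuccAbove (fun _ => ℝ) i).measure_preimage
      (measurableSet_noGapMin m a t).nullMeasurableSet, Measure.volume_eq_prod,
      Measure.prod_apply (measurableSet_noGapMin m a t),
      ← lintegral_indicator (measurableSet_Ioc.inter measurableSet_Iio)]
    refine lintegral_congr fun y => ?_
    by_cases hy : y ∈ Set.Ioc a 1 ∩ Set.Iio (a + t)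
    · rw [Set.indicator_of_mem hy]
      congr 1
      ext x
      simp only [Set.mem_preimage, noGapMin, Set.mem_ofPred_eq, hy, true_and]
    · rw [Set.indicator_of_notMem hy]
      convert measure_empty (μ := (volume : Measure (Fin m → ℝ)))
      exact Set.eq_empty_of_forall_notMem fun x hx => hy hx.1
  rw [noGap_succ_eq_iUnion m a t, measure_iUnion (pairwise_disjoint_noGapMin m a t)
    (fun i => (MeasurableEquiv.measurable _) (measurableSet_noGapMin m a t)), tsum_fintype]
  rw [Finset.sum_congr rfl fun i _ => hpiece i, Finset.sum_const, Finset.card_univ,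
    Fintype.card_fin, nsmul_eq_mul]

/-- The volume of `noGap m a t`. -/
noncomputable def noGapVol (m : ℕ) (a t : ℝ) : ℝ :=
  ∑ k ∈ Finset.range (m + 2), (-1 : ℝ) ^ k * (m + 1).choose k * truncPow m (1 - a - k * t)

theorem intervalIntegrable_truncPow_sub (m : ℕ) (s b c : ℝ) :
    IntervalIntegrable (fun y => truncPow m (1 - y - s)) volume b c := by
  have : Antitone fun y => truncPow m (1 - y - s) := fun y z h =>
    monotone_truncPow m (by linarith)
  exact this.intervalIntegrable

theorem intervalIntegrable_noGapVol (m : ℕ) (t b c : ℝ) :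
    IntervalIntegrable (fun y => noGapVol m y t) volume b c := by
  unfold noGapVol
  simpa only [Finset.sum_fn] using IntervalIntegrable.sum (Finset.range (m + 2)) fun k _ =>
    (intervalIntegrable_truncPow_sub m (k * t) b c).const_mul ((-1 : ℝ) ^ k * (m + 1).choose k)

theorem mul_integral_noGapVol (m : ℕ) {a t : ℝ} (ha : a ≤ 1) (ht : 0 < t) :
    (m + 1) * ∫ y in a..min 1 (a + t), noGapVol m y t = noGapVol (m + 1) a t := by
  have hle : a ≤ min 1 (a + t) := le_min ha (by linarith)
  have hterm : ∀ k : ℕ, (m + 1) * ∫ y in a..min 1 (a + t), truncPow m (1 - y - k * t) =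
      truncPow (m + 1) (1 - a - k * t) - truncPow (m + 1) (1 - a - (k + 1 : ℕ) * t) := by
    intro k
    have hk : 0 ≤ k * t := by positivity
    have h1 : ∫ y in a..min 1 (a + t), truncPow m (1 - y - k * t) =
        ∫ w in (1 - k * t - min 1 (a + t))..(1 - k * t - a), truncPow m w := by
      rw [← intervalIntegral.integral_comp_sub_left]
      congr 1
      ext y
      congr 1
      ring
    rw [h1, mul_integral_truncPow m (by linarith)]
    congr 1
    · congr 1
      ring
    · push_cast
      rcases le_total 1 (a + t) with h | h
      · rw [min_eq_left h, truncPow_succ_of_nonpos (by linarith),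
          truncPow_succ_of_nonpos (by linarith)]
      · rw [min_eq_right h]
        congr 1
        ring
  unfold noGapVol
  rw [intervalIntegral.integral_finsetSum
    fun k _ => (intervalIntegrable_truncPow_sub m _ _ _).const_mul _, Finset.mul_sum]
  have hsum : ∀ k ∈ Finset.range (m + 2), ((m : ℝ) + 1) * ∫ y in a..min 1 (a + t),
      (-1 : ℝ) ^ k * (m + 1).choose k * truncPow m (1 - y - k * t) =
        (-1 : ℝ) ^ k * (m + 1).choose k * truncPow (m + 1) (1 - a - k * t) +
        (-1 : ℝ) ^ (k + 1) * (m + 1).choose k * truncPow (m + 1) (1 - a - (k + 1 : ℕ) * t) := by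
    intro k _
    rw [intervalIntegral.integral_const_mul, mul_left_comm, hterm k]
    ring
  rw [Finset.sum_congr rfl hsum, Finset.sum_add_distrib, Finset.sum_range_succ' _ (m + 2)]
  have hlast : ∑ k ∈ Finset.range (m + 2),
      (-1 : ℝ) ^ k * (m + 1).choose k * truncPow (m + 1) (1 - a - k * t) =
      ∑ k ∈ Finset.range (m + 2), (-1 : ℝ) ^ (k + 1) * (m + 1).choose (k + 1) *
        truncPow (m + 1) (1 - a - (k + 1 : ℕ) * t) + truncPow (m + 1) (1 - a) := by
    have h := Finset.sum_range_succ (fun k : ℕ =>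
      (-1 : ℝ) ^ k * (m + 1).choose k * truncPow (m + 1) (1 - a - k * t)) (m + 2)
    rw [Nat.choose_succ_self, Finset.sum_range_succ'] at h
    simpa using h.symm
  have hpascal : ∀ k : ℕ, ((m + 1 + 1).choose (k + 1) : ℝ) =
      (m + 1).choose k + (m + 1).choose (k + 1) := fun k => by
    exact_mod_cast Nat.choose_succ_succ (m + 1) k
  rw [hlast]
  simp only [hpascal, mul_add, add_mul, Finset.sum_add_distrib]
  simp
  ring

theorem volume_noGap (m : ℕ) {t : ℝ} (ht : 0 < t) : ∀ a ≤ (1 : ℝ),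
    0 ≤ noGapVol m a t ∧ volume (noGap m a t) = ENNReal.ofReal (noGapVol m a t) := by
  induction m with
  | zero =>
    intro a ha
    rw [noGapVol, Finset.sum_range_succ, Finset.sum_range_one,
      truncPow_of_nonneg (by simpa using ha)]
    rcases lt_or_ge 1 (a + t) with h | h
    · rw [truncPow_of_neg (by push_cast; linarith)]
      have : noGap 0 a t = Set.univ := by
        ext x
        simp [noGap, h, Function.injective_of_subsingleton]
      simp [this, volume_pi]
    · rw [truncPow_of_nonneg (by push_cast; linarith)]
      have : noGap 0 a t = ∅ := by
        ext x
        simp [noGap, h]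
      simp [this]
  | succ m ih =>
    intro a ha
    have hle : a ≤ min 1 (a + t) := le_min ha (by linarith)
    have hset : (Set.Ioc a 1 ∩ Set.Iio (a + t) : Set ℝ) =ᵐ[volume]
        Set.Ioc a (min 1 (a + t)) := by
      rw [← Set.Ioc_inter_Iic]
      exact Filter.EventuallyEq.rfl.inter Iio_ae_eq_Iic
    have hnonneg : ∀ y ∈ Set.Ioc a (min 1 (a + t)), 0 ≤ noGapVol m y t := fun y hy =>
      (ih y (hy.2.trans (min_le_left _ _))).1
    have hint : 0 ≤ ∫ y in a..min 1 (a + t), noGapVol m y t := by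
      rw [intervalIntegral.integral_of_le hle]
      exact setIntegral_nonneg measurableSet_Ioc hnonneg
    rw [← mul_integral_noGapVol m ha ht]
    refine ⟨by positivity, ?_⟩
    rw [volume_noGap_succ m a t, setLIntegral_congr hset,
      setLIntegral_congr_fun measurableSet_Ioc
        (fun y hy => (ih y (hy.2.trans (min_le_left _ _))).2),
      ENNReal.ofReal_mul (by positivity), intervalIntegral.integral_of_le hle,
      ofReal_integral_eq_lintegral_ofReal
        ((intervalIntegrable_iff_integrableOn_Ioc_of_le hle).1 (intervalIntegrable_noGapVol m t _ _))
        (ae_restrict_of_forall_mem measurableSet_Ioc hnonneg)]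
    congr 1
    rw [← ENNReal.ofReal_natCast]
    push_cast
    rfl

theorem le_cost0 {m : ℕ} [NeZero m] {x : Fin m → ℝ} {s r : ℝ} (hs : s ∈ Set.Icc (0 : ℝ) 1)
    (h : ∀ j, r ≤ |s - x j|) : r ≤ cost0 x Finset.univ := by
  have hne : (Finset.univ : Finset (Fin m)).Nonempty := Finset.univ_nonempty
  have : Nonempty (Finset.univ : Finset (Fin m)) := hne.to_subtype
  rw [cost0, if_pos hne]
  refine le_ciSup_of_le ⟨1 + |x 0|, ?_⟩ ⟨s, hs⟩ (le_ciInf fun j => h j.1)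
  rintro _ ⟨u, rfl⟩
  refine (ciInf_le (Set.finite_range _).bddBelow ⟨0, Finset.mem_univ _⟩).trans
    ((abs_sub _ _).trans ?_)
  rw [abs_of_nonneg u.2.1]
  linarith [u.2.2]

theorem cost0_le {m : ℕ} [NeZero m] {x : Fin m → ℝ} {c : ℝ}
    (h : ∀ s ∈ Set.Icc (0 : ℝ) 1, ∃ j, |s - x j| ≤ c) : cost0 x Finset.univ ≤ c := by
  rw [cost0, if_pos Finset.univ_nonempty]
  have : Nonempty (Set.Icc (0 : ℝ) 1) := ⟨⟨0, by simp⟩⟩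
  refine ciSup_le fun s => ?_
  obtain ⟨j, hj⟩ := h s.1 s.2
  exact (ciInf_le (Set.finite_range _).bddBelow ⟨j, Finset.mem_univ _⟩).trans hj

theorem cost0_nonneg {m : ℕ} [NeZero m] (x : Fin m → ℝ) : 0 ≤ cost0 x Finset.univ :=
  le_cost0 (s := 0) (by simp) fun _ => abs_nonneg _

theorem continuous_cost0 (m : ℕ) [NeZero m] :
    Continuous fun x : Fin m → ℝ => cost0 x Finset.univ := by
  refine (LipschitzWith.of_le_add fun x y => cost0_le fun s hs => ?_).continuous
  obtain ⟨j, hj⟩ := Finite.exists_min fun j => |s - y j|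
  refine ⟨j, ?_⟩
  calc |s - x j| ≤ |s - y j| + |y j - x j| := abs_sub_le _ _ _
    _ ≤ cost0 y Finset.univ + dist x y := by
      refine add_le_add (le_cost0 hs hj) ?_
      rw [← Real.dist_eq, dist_comm]
      exact dist_le_pi_dist x y j

/-- A configuration with a gap of length `2 r` has cost at least `r`. -/
theorem le_cost0_of_notMem_noGap {m : ℕ} [NeZero m] {x : Fin m → ℝ} {r : ℝ} (hr : 0 < r)
    (hinj : Function.Injective x) (hx : ∀ i, x i ∈ Set.Ioc (0 : ℝ) 1)
    (h : x ∉ noGap m 0 (2 * r)) : r ≤ cost0 x Finset.univ := by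
  suffices hp : ∃ p, 0 ≤ p ∧ p + 2 * r ≤ 1 ∧ ∀ j, x j ≤ p ∨ p + 2 * r ≤ x j by
    obtain ⟨p, hp0, hp1, hp⟩ := hp
    refine le_cost0 (s := p + r) ⟨by linarith, by linarith⟩ fun j => ?_
    rcases hp j with hj | hj
    · exact le_trans (by linarith) (le_abs_self _)
    · exact le_trans (by linarith) (neg_le_abs _)
  by_contra! hp
  refine h ⟨hinj, hx, ?_, fun i => ?_⟩
  · rcases lt_or_ge 1 (0 + 2 * r) with h1 | h1
    · exact .inl h1
    · obtain ⟨j, hj⟩ := hp 0 le_rfl h1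
      exact .inr ⟨j, hj.2⟩
  · rcases lt_or_ge 1 (x i + 2 * r) with h1 | h1
    · exact .inl h1
    · exact .inr (hp (x i) (hx i).1.le h1)

/-- If all gaps are shorter than `2 r`, only the two end gaps can push the cost above `r`, each by
at most half of its length. -/
theorem cost0_le_of_mem_noGap {m : ℕ} [NeZero m] {x : Fin m → ℝ} {r : ℝ}
    (h : x ∈ noGap m 0 (2 * r)) :
    cost0 x Finset.univ ≤ r + (⨅ j, x j) / 2 + (⨅ j, (1 - x j)) / 2 := by
  obtain ⟨-, hx, h0, hgap⟩ := h
  obtain ⟨i, hi⟩ := Finite.exists_min x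
  obtain ⟨k, hk⟩ := Finite.exists_max x
  have hinf : ⨅ j, x j = x i :=
    le_antisymm (ciInf_le (Set.finite_range _).bddBelow i) (le_ciInf hi)
  have hinf' : ⨅ j, (1 - x j) = 1 - x k :=
    le_antisymm (ciInf_le (Set.finite_range _).bddBelow k)
      (le_ciInf fun j => by linarith [hk j])
  rw [hinf, hinf']
  have hi0 := hx i
  have hk0 := hx k
  refine cost0_le fun s hs => ?_
  rcases lt_or_ge s (x i) with hsi | hsi
  · have : x i < 2 * r := by
      rcases h0 with h0 | ⟨j, h0⟩
      · linarith
      · linarith [hi j]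
    exact ⟨i, abs_le.2 ⟨by linarith [hs.1], by linarith⟩⟩
  rcases lt_or_ge (x k) s with hsk | hsk
  · have : 1 < x k + 2 * r := by
      rcases hgap k with h | ⟨j, h, -⟩
      · exact h
      · exact absurd h (hk j).not_gt
    exact ⟨k, abs_le.2 ⟨by linarith, by linarith [hs.2]⟩⟩
  obtain ⟨p, hp, hpmax⟩ := (Finset.univ.filter fun j => x j ≤ s).exists_max_image x ⟨i, by simpa⟩
  simp only [Finset.mem_filter, Finset.mem_univ, true_and] at hp hpmax
  have hq : ∃ q, s ≤ x q ∧ x q < x p + 2 * r := by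
    rcases hgap p with h | ⟨j, h1, h2⟩
    · exact ⟨k, hsk, by linarith⟩
    · refine ⟨j, ?_, h2⟩
      by_contra! hj
      exact absurd (hpmax j hj.le) h1.not_ge
  obtain ⟨q, hq1, hq2⟩ := hq
  rcases le_total (s - x p) r with hr | hr
  · exact ⟨p, abs_le.2 ⟨by linarith, by linarith⟩⟩
  · exact ⟨q, abs_le.2 ⟨by linarith, by linarith⟩⟩

theorem ae_injective (m : ℕ) : ∀ᵐ x : Fin m → ℝ, Function.Injective x := by
  have h : ∀ i j : Fin m, ∀ᵐ x : Fin m → ℝ, x i = x j → i = j := by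
    intro i j
    by_cases hij : i = j
    · simp [hij]
    · let L : (Fin m → ℝ) →ₗ[ℝ] ℝ := LinearMap.proj (R := ℝ) (φ := fun _ => ℝ) i - LinearMap.proj j
      have hL : L.ker ≠ ⊤ := by
        intro h
        have : L (Pi.single i 1) = 0 := by
          rw [← LinearMap.mem_ker, h]
          trivial
        simp [L, Ne.symm hij] at this
      refine measure_mono_null (fun x hx => ?_)
        (Measure.addHaar_submodule (volume : Measure (Fin m → ℝ)) L.ker hL)
      have hx' : ¬(x i = x j → i = j) := hx
      push Not at hx'
      simp [L, hx'.1]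
  filter_upwards [ae_all_iff.2 fun i => ae_all_iff.2 (h i)] with x hx i j using hx i j

/-- The law of `m` independent uniform points of `[0, 1]`. -/
noncomputable abbrev cubeMeasure (m : ℕ) : Measure (Fin m → ℝ) :=
  volume.restrict (Set.univ.pi fun _ => Set.Icc (0 : ℝ) 1)

theorem cubeMeasure_apply_univ (m : ℕ) : cubeMeasure m Set.univ = 1 := by
  rw [Measure.restrict_apply_univ, volume_pi_pi]
  simp

instance (m : ℕ) : IsProbabilityMeasure (cubeMeasure m) := ⟨cubeMeasure_apply_univ m⟩

theorem ae_cubeMeasure_mem_Ioc (m : ℕ) :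
    ∀ᵐ x ∂cubeMeasure m, ∀ i, x i ∈ Set.Ioc (0 : ℝ) 1 := by
  have h : (Set.univ.pi fun _ : Fin m => Set.Icc (0 : ℝ) 1) =ᵐ[volume]
      Set.univ.pi fun _ => Set.Ioc (0 : ℝ) 1 :=
    Measure.ae_eq_set_pi fun _ _ => Ioc_ae_eq_Icc.symm
  rw [cubeMeasure, Measure.restrict_congr_set h]
  filter_upwards [ae_restrict_mem (MeasurableSet.univ_pi fun _ => measurableSet_Ioc)] with x hx i
    using hx i trivial

/-- The tail of half the largest spacing. -/
noncomputable def gapTail (m : ℕ) (r : ℝ) : ℝ :=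
  ∑ k ∈ Finset.range (m + 1), (-1 : ℝ) ^ k * (m + 1).choose (k + 1) *
    truncPow m (1 - (2 * (k + 1 : ℝ)) * r)

theorem noGapVol_eq_one_sub_gapTail (m : ℕ) (r : ℝ) :
    noGapVol m 0 (2 * r) = 1 - gapTail m r := by
  rw [noGapVol, Finset.sum_range_succ', gapTail, truncPow_of_nonneg (by simp)]
  have h : ∀ k ∈ Finset.range (m + 1), (-1 : ℝ) ^ (k + 1) * (m + 1).choose (k + 1) *
      truncPow m (1 - 0 - (k + 1 : ℕ) * (2 * r)) = -((-1 : ℝ) ^ k * (m + 1).choose (k + 1) *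
        truncPow m (1 - (2 * (k + 1 : ℝ)) * r)) := by
    intro k _
    have : 1 - 0 - ((k + 1 : ℕ) : ℝ) * (2 * r) = 1 - (2 * (k + 1 : ℝ)) * r := by
      push_cast
      ring
    rw [this, pow_succ]
    ring
  rw [Finset.sum_congr rfl h, Finset.sum_neg_distrib]
  simp
  ring

theorem cubeMeasure_noGap (m : ℕ) (t : ℝ) : cubeMeasure m (noGap m 0 t) = volume (noGap m 0 t) :=
  Measure.restrict_eq_self _ fun _ hx i _ => ⟨(hx.2.1 i).1.le, (hx.2.1 i).2⟩

theorem cubeMeasure_compl_noGap (m : ℕ) {r : ℝ} (hr : 0 < r) :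
    0 ≤ gapTail m r ∧
      cubeMeasure m (noGap m 0 (2 * r))ᶜ = ENNReal.ofReal (gapTail m r) := by
  have hr' : 0 < 2 * r := by positivity
  have hvol := volume_noGap m hr' 0 zero_le_one
  rw [noGapVol_eq_one_sub_gapTail] at hvol
  have hle : cubeMeasure m (noGap m 0 (2 * r)) ≤ 1 := prob_le_one
  have hcompl := prob_compl_eq_one_sub (μ := cubeMeasure m) (measurableSet_noGap m 0 (2 * r))
  rw [cubeMeasure_noGap, hvol.2] at hle hcompl
  have h0 : 0 ≤ gapTail m r := by
    rw [ENNReal.ofReal_le_one] at hle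
    linarith
  refine ⟨h0, ?_⟩
  rw [hcompl, ← ENNReal.ofReal_one, ← ENNReal.ofReal_sub _ hvol.1]
  congr 1
  ring

theorem lintegral_gapTail (m : ℕ) :
    ∫⁻ r in Set.Ioi (0 : ℝ), ENNReal.ofReal (gapTail m r) =
      ENNReal.ofReal (H (m + 1) / (2 * (m + 1))) := by
  have hk : ∀ k : ℕ, (0 : ℝ) < 2 * (k + 1 : ℝ) := fun k => by positivity
  have hint : ∀ k ∈ Finset.range (m + 1), IntegrableOn (fun r => (-1 : ℝ) ^ k *
      (m + 1).choose (k + 1) * truncPow m (1 - (2 * (k + 1 : ℝ)) * r)) (Set.Ioi 0) := fun k _ =>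
    (integral_truncPow_one_sub_mul m (hk k)).1.const_mul _
  rw [← ofReal_integral_eq_lintegral_ofReal (f := gapTail m) (integrable_finsetSum _ hint)
    (ae_restrict_of_forall_mem measurableSet_Ioi fun r hr => (cubeMeasure_compl_noGap m hr).1)]
  congr 1
  simp only [gapTail]
  rw [integral_finsetSum _ hint, ← sum_alternating_choose_div_eq_H, Finset.sum_div]
  refine Finset.sum_congr rfl fun k _ => ?_
  rw [integral_const_mul, (integral_truncPow_one_sub_mul m (hk k)).2]
  have : (k : ℝ) + 1 ≠ 0 := by positivity
  field_simp

/-- The expected minimum of `m` independent variables whose tails are at most uniform. -/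
theorem lintegral_iInf_le {m : ℕ} [NeZero m] {g : ℝ → ℝ} (hg : Continuous g)
    (h0 : ∀ u ∈ Set.Icc (0 : ℝ) 1, 0 ≤ g u)
    (htail : ∀ t > 0, volume (Set.Icc (0 : ℝ) 1 ∩ {u | t < g u}) ≤ ENNReal.ofReal (1 - t)) :
    ∫⁻ x, ENNReal.ofReal (⨅ j, g (x j)) ∂cubeMeasure m ≤ ENNReal.ofReal (1 / (m + 1)) := by
  have hmeas : Measurable fun x : Fin m → ℝ => ⨅ j, g (x j) :=
    .iInf fun j => hg.measurable.comp (measurable_pi_apply j)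
  have hcube : MeasurableSet (Set.univ.pi fun _ : Fin m => Set.Icc (0 : ℝ) 1) :=
    .univ_pi fun _ => measurableSet_Icc
  rw [lintegral_eq_lintegral_meas_lt _ (ae_restrict_of_forall_mem hcube fun x hx =>
    le_ciInf fun j => h0 _ (hx j trivial)) hmeas.aemeasurable]
  have hint := integral_truncPow_one_sub_mul m (zero_lt_one (α := ℝ))
  simp only [one_mul] at hint
  rw [← hint.2, ofReal_integral_eq_lintegral_ofReal hint.1
    (ae_of_all _ fun r => truncPow_nonneg m _)]
  refine setLIntegral_mono' measurableSet_Ioi fun t ht => ?_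
  calc cubeMeasure m {x | t < ⨅ j, g (x j)}
      = volume ({x | t < ⨅ j, g (x j)} ∩ Set.univ.pi fun _ : Fin m => Set.Icc (0 : ℝ) 1) :=
        Measure.restrict_apply' hcube
    _ ≤ volume (Set.univ.pi fun _ : Fin m => Set.Icc (0 : ℝ) 1 ∩ {u | t < g u}) := by
        refine measure_mono fun x hx j _ => ⟨hx.2 j trivial, ?_⟩
        exact lt_of_lt_of_le (show t < ⨅ j, g (x j) from hx.1) (ciInf_le (Set.finite_range _).bddBelow j)
    _ = volume (Set.Icc (0 : ℝ) 1 ∩ {u | t < g u}) ^ m := by simp [volume_pi_pi]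
    _ ≤ ENNReal.ofReal (1 - t) ^ m := by gcongr; exact htail t ht
    _ ≤ ENNReal.ofReal (truncPow m (1 - t)) := by
        rcases lt_or_ge (1 - t) 0 with h | h
        · simp [ENNReal.ofReal_of_nonpos h.le, NeZero.ne m]
        · rw [truncPow_of_nonneg h, ENNReal.ofReal_pow h]

theorem randCost0_eq_toReal (m : ℕ) [NeZero m] : randCost0 m =
    (∫⁻ x, ENNReal.ofReal (cost0 x Finset.univ) ∂cubeMeasure m).toReal :=
  integral_eq_lintegral_of_nonneg_ae (ae_of_all _ cost0_nonneg)
    (continuous_cost0 m).aestronglyMeasurable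

theorem le_lintegral_cost0 (m : ℕ) [NeZero m] :
    ENNReal.ofReal (H (m + 1) / (2 * (m + 1))) ≤
      ∫⁻ x, ENNReal.ofReal (cost0 x Finset.univ) ∂cubeMeasure m := by
  rw [lintegral_eq_lintegral_meas_le _ (ae_of_all _ cost0_nonneg)
    (continuous_cost0 m).measurable.aemeasurable, ← lintegral_gapTail]
  refine setLIntegral_mono' measurableSet_Ioi fun r hr => ?_
  rw [← (cubeMeasure_compl_noGap m hr).2]
  refine measure_mono_ae ?_
  filter_upwards [ae_cubeMeasure_mem_Ioc m, ae_restrict_of_ae (ae_injective m)] with x hx hinj h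
  exact le_cost0_of_notMem_noGap hr hinj hx h

theorem lintegral_cost0_le (m : ℕ) [NeZero m] :
    ∫⁻ x, ENNReal.ofReal (cost0 x Finset.univ) ∂cubeMeasure m ≤
      ENNReal.ofReal ((H (m + 1) + 2) / (2 * (m + 1))) := by
  set D : (Fin m → ℝ) → ℝ := fun x => ⨅ j, x j with hD
  set D' : (Fin m → ℝ) → ℝ := fun x => ⨅ j, (1 - x j) with hD'
  set Z : (Fin m → ℝ) → ℝ := fun x => max (cost0 x Finset.univ - D x / 2 - D' x / 2) 0 with hZ
  have hDm : Measurable D := .iInf fun j => measurable_pi_apply j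
  have hDm' : Measurable D' := .iInf fun j => (measurable_pi_apply j).const_sub 1
  have hZm : Measurable Z :=
    (((continuous_cost0 m).measurable.sub (hDm.div_const 2)).sub (hDm'.div_const 2)).max
      measurable_const
  have hbound : ∀ x, ENNReal.ofReal (cost0 x Finset.univ) ≤ ENNReal.ofReal (Z x) +
      ENNReal.ofReal (1 / 2) * ENNReal.ofReal (D x) +
      ENNReal.ofReal (1 / 2) * ENNReal.ofReal (D' x) := by
    intro x
    rw [← ENNReal.ofReal_mul (by norm_num), ← ENNReal.ofReal_mul (by norm_num)]
    refine le_trans (ENNReal.ofReal_le_ofReal ?_) (ENNReal.ofReal_add_le.trans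
      (add_le_add_left ENNReal.ofReal_add_le _))
    have := le_max_left (cost0 x Finset.univ - D x / 2 - D' x / 2) 0
    simp only [hZ]
    linarith
  have hZint : ∫⁻ x, ENNReal.ofReal (Z x) ∂cubeMeasure m ≤
      ENNReal.ofReal (H (m + 1) / (2 * (m + 1))) := by
    rw [lintegral_eq_lintegral_meas_lt (f := Z) _ (ae_of_all _ fun x => le_max_right _ _)
      hZm.aemeasurable, ← lintegral_gapTail]
    refine setLIntegral_mono' measurableSet_Ioi fun r hr => ?_
    rw [← (cubeMeasure_compl_noGap m hr).2]
    refine measure_mono fun x hx hgap => ?_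
    have hx' : r < Z x := hx
    have h := cost0_le_of_mem_noGap hgap
    rcases lt_max_iff.1 hx' with h' | h'
    · simp only [hD, hD'] at h'
      linarith
    · exact lt_asymm hr h'
  have hDint : ∫⁻ x, ENNReal.ofReal (D x) ∂cubeMeasure m ≤ ENNReal.ofReal (1 / (m + 1)) := by
    refine lintegral_iInf_le (g := fun u => u) continuous_id (fun u hu => hu.1) fun t _ => ?_
    rw [← Real.volume_Ioc]
    exact measure_mono fun u hu => ⟨hu.2, hu.1.2⟩
  have hDint' : ∫⁻ x, ENNReal.ofReal (D' x) ∂cubeMeasure m ≤ ENNReal.ofReal (1 / (m + 1)) := by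
    refine lintegral_iInf_le (g := fun u => 1 - u) (by fun_prop)
      (fun u hu => by linarith [hu.2]) fun t _ => ?_
    rw [← sub_zero (1 - t), ← Real.volume_Ico]
    exact measure_mono fun u hu => ⟨hu.1.1, by linarith [show t < 1 - u from hu.2]⟩
  calc ∫⁻ x, ENNReal.ofReal (cost0 x Finset.univ) ∂cubeMeasure m
      ≤ ∫⁻ x, (ENNReal.ofReal (Z x) + ENNReal.ofReal (1 / 2) * ENNReal.ofReal (D x) +
          ENNReal.ofReal (1 / 2) * ENNReal.ofReal (D' x)) ∂cubeMeasure m := lintegral_mono hbound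
    _ = ∫⁻ x, ENNReal.ofReal (Z x) ∂cubeMeasure m +
          ENNReal.ofReal (1 / 2) * ∫⁻ x, ENNReal.ofReal (D x) ∂cubeMeasure m +
          ENNReal.ofReal (1 / 2) * ∫⁻ x, ENNReal.ofReal (D' x) ∂cubeMeasure m := by
        rw [lintegral_add_right _ (hDm'.ennreal_ofReal.const_mul _),
          lintegral_add_right _ (hDm.ennreal_ofReal.const_mul _),
          lintegral_const_mul _ hDm.ennreal_ofReal, lintegral_const_mul _ hDm'.ennreal_ofReal]
    _ ≤ ENNReal.ofReal (H (m + 1) / (2 * (m + 1))) +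
          ENNReal.ofReal (1 / 2) * ENNReal.ofReal (1 / (m + 1)) +
          ENNReal.ofReal (1 / 2) * ENNReal.ofReal (1 / (m + 1)) := by gcongr
    _ = ENNReal.ofReal ((H (m + 1) + 2) / (2 * (m + 1))) := by
        have hH : 0 ≤ H (m + 1) := Finset.sum_nonneg fun i _ => by positivity
        rw [← ENNReal.ofReal_mul (by norm_num), ← ENNReal.ofReal_add (by positivity)
          (by positivity), ← ENNReal.ofReal_add (by positivity) (by positivity)]
        congr 1
        field_simp
        ring

/-- `E[C_0(x^{rand,m})] ≥ H_{m+1}/(2(m+1))` for all `m ≥ 0`, and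
`E[C_0(x^{rand,m})] ≤ (H_{m-1} + 4)/(2(m+1))` for all `m ≥ 2`. -/
theorem randCost0_bounds :
    (∀ m : ℕ, H (m + 1) / (2 * ((m : ℝ) + 1)) ≤ randCost0 m) ∧
    (∀ m : ℕ, 2 ≤ m → randCost0 m ≤ (H (m - 1) + 4) / (2 * ((m : ℝ) + 1))) := by
  have hH : ∀ n, 0 ≤ H n := fun n => Finset.sum_nonneg fun i _ => by positivity
  constructor
  · intro m
    rcases Nat.eq_zero_or_pos m with rfl | hm
    · have h : randCost0 0 = ∫ _, (1 : ℝ) ∂cubeMeasure 0 :=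
          integral_congr_ae (ae_of_all _ fun x => by simp [cost0])
      rw [h, integral_const, probReal_univ]
      simp [H]
      norm_num
    · have : NeZero m := ⟨hm.ne'⟩
      have hnn := hH (m + 1)
      rw [randCost0_eq_toReal, ← ENNReal.toReal_ofReal (r := H (m + 1) / (2 * ((m : ℝ) + 1)))
        (by positivity)]
      exact ENNReal.toReal_mono
        ((lintegral_cost0_le m).trans_lt ENNReal.ofReal_lt_top).ne (le_lintegral_cost0 m)
  · intro m hm
    have : NeZero m := ⟨by omega⟩
    have hnn := hH (m + 1)
    have hrand : randCost0 m ≤ (H (m + 1) + 2) / (2 * (m + 1)) := by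
      rw [randCost0_eq_toReal]
      exact ENNReal.toReal_le_of_le_ofReal (by positivity) (lintegral_cost0_le m)
    refine hrand.trans ?_
    obtain ⟨n, rfl⟩ : ∃ n, m = n + 1 := ⟨m - 1, by omega⟩
    have hstep : H (n + 1 + 1) ≤ H n + 2 := by
      simp only [H, Finset.sum_range_succ]
      have h1 : 1 / ((n : ℝ) + 1) ≤ 1 := by
        rw [div_le_one (by positivity)]
        linarith [n.cast_nonneg (α := ℝ)]
      have h2 : 1 / (((n + 1 : ℕ) : ℝ) + 1) ≤ 1 := by
        rw [div_le_one (by positivity)]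
        linarith [(n + 1).cast_nonneg (α := ℝ)]
      linarith
    rw [Nat.add_sub_cancel]
    gcongr ?_ / _
    linarith
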